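/- arXiv:0902.4045 — 9 statements merged into one kernel-verified Lean document; each statement's English description precedes it below -/
import Mathlib

section
/- Let A be an m×n real matrix with nonnegative entries and let k be a positive integer with k < n/2. Then the following two statements are equivalent: (1) every nonnegative k-sparse vector x₀ ∈ ℝⁿ is the unique solution of the program: minimize ‖x‖₁ subject to Ax = Ax₀ and x ≥ 0; (2) for every nonzero vector w in the null space of A and every index set S ⊆ {1,…,n} with |S| = k such that every entry of w with index outside S is nonnegative, one has ∑_{i=1}^n w_i > 0. -/
/-- For a nonnegative m×n matrix A and 0 < k < n/2, every nonnegative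
k-sparse vector is the unique ℓ1 minimizer over {x ≥ 0 : Ax = Ax₀} iff every nonzero
null-space vector w that is nonnegative outside some index set of size k has positive
entry sum. -/
theorem stmt_0 (m n k : ℕ) (hk : 0 < k) (hkn : (k : ℝ) < (n : ℝ) / 2)
    (A : Matrix (Fin m) (Fin n) ℝ) (hA : ∀ i j, 0 ≤ A i j) :
    (∀ x₀ : Fin n → ℝ, (∀ i, 0 ≤ x₀ i) →
      (Finset.univ.filter (fun i => x₀ i ≠ 0)).card ≤ k →
      ∀ x : Fin n → ℝ, (∀ i, 0 ≤ x i) → A.mulVec x = A.mulVec x₀ → x ≠ x₀ →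
        ∑ i, |x₀ i| < ∑ i, |x i|)
    ↔
    (∀ w : Fin n → ℝ, w ≠ 0 → A.mulVec w = 0 →
      ∀ S : Finset (Fin n), S.card = k → (∀ i, i ∉ S → 0 ≤ w i) →
        0 < ∑ i, w i) := by
  constructor
  · intro h w hw hAw S hS hpos
    have hd : ∀ i, max (w i) 0 - max (-w i) 0 = w i := by
      intro i
      rcases le_total (w i) 0 with h0 | h0
      · rw [max_eq_right h0, max_eq_left (by linarith)]; ring
      · rw [max_eq_left h0, max_eq_right (by linarith)]; ring
    have hfun : (fun i => max (w i) 0) = (fun i => max (-w i) 0) + w := by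
      funext i
      have := hd i
      simp only [Pi.add_apply]
      linarith
    have key := h (fun i => max (-w i) 0) (fun i => le_max_right _ _) ?_
      (fun i => max (w i) 0) (fun i => le_max_right _ _) ?_ ?_
    · simp only [abs_of_nonneg (le_max_right _ (0:ℝ))] at key
      have : ∑ i, w i = ∑ i, max (w i) 0 - ∑ i, max (-w i) 0 := by
        rw [← Finset.sum_sub_distrib]
        exact Finset.sum_congr rfl (fun i _ => (hd i).symm)
      linarith
    · rw [← hS]
      apply Finset.card_le_card
      intro i hi
      by_contra hiS
      have := hpos i hiS
      simp only [Finset.mem_filter] at hi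
      exact hi.2 (max_eq_right (by linarith))
    · rw [hfun, Matrix.mulVec_add, hAw, add_zero]
    · intro he
      apply hw
      funext i
      have h1 := congrFun he i
      have h2 := hd i
      simp only [Pi.zero_apply]
      linarith
  · intro h x₀ hx₀ hc x hx hAx hne
    have hkn' : k ≤ Fintype.card (Fin n) := by
      rw [Fintype.card_fin]
      have h0 : (0:ℝ) ≤ k := Nat.cast_nonneg k
      have : (k:ℝ) ≤ n := by linarith
      exact_mod_cast this
    obtain ⟨S, hsub, hS⟩ := Finset.exists_superset_card_eq hc hkn'
    have key := h (x - x₀) (sub_ne_zero.mpr hne)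
      (by rw [Matrix.mulVec_sub, hAx, sub_self]) S hS ?_
    · simp only [Pi.sub_apply, Finset.sum_sub_distrib] at key
      simp only [abs_of_nonneg (hx _), abs_of_nonneg (hx₀ _)]
      linarith
    · intro i hi
      have : x₀ i = 0 := by
        by_contra h0
        exact hi (hsub (by simp [h0]))
      simp only [Pi.sub_apply, this, sub_zero]
      exact hx i
end

section
/- Let A be an m×n real matrix with nonnegative entries whose column sums are all equal to a common constant d > 0, and let k be a positive integer with k ≤ n. Then the following three statements are equivalent: (1) for every nonnegative k-sparse vector x₀ ∈ ℝⁿ, the set {x ∈ ℝⁿ : Ax = Ax₀, x ≥ 0} equals {x₀}; (2) for every nonzero vector w in the null space of A and every index set S ⊆ {1,…,n} with |S| = k such that every entry of w with index outside S is nonnegative, one has ∑_{i=1}^n w_i > 0; (3) for every index set S ⊆ {1,…,n} with |S| = k, there exists no nonzero vector w in the null space of A whose entries with indices outside S are all nonnegative. -/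
/-- For a nonnegative m×n matrix A with constant column sum d > 0 and
0 < k ≤ n, three conditions are equivalent: (1) every nonnegative k-sparse x₀ is the
unique point of {x : Ax = Ax₀, x ≥ 0}; (2) every nonzero null-space vector nonnegative
outside some size-k set S has positive entry sum; (3) for every size-k set S there is
no nonzero null-space vector nonnegative outside S. -/
theorem stmt_1 (m n k : ℕ) (d : ℝ) (hd : 0 < d) (hk : 0 < k) (hkn : k ≤ n)
    (A : Matrix (Fin m) (Fin n) ℝ) (hA : ∀ i j, 0 ≤ A i j)
    (hcol : ∀ j, ∑ i, A i j = d) :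
    ((∀ x₀ : Fin n → ℝ, (∀ i, 0 ≤ x₀ i) →
        (Finset.univ.filter (fun i => x₀ i ≠ 0)).card ≤ k →
        {x : Fin n → ℝ | A.mulVec x = A.mulVec x₀ ∧ ∀ i, 0 ≤ x i} = {x₀}) ↔
      (∀ w : Fin n → ℝ, w ≠ 0 → A.mulVec w = 0 →
        ∀ S : Finset (Fin n), S.card = k → (∀ i, i ∉ S → 0 ≤ w i) →
          0 < ∑ i, w i))
    ∧
    ((∀ w : Fin n → ℝ, w ≠ 0 → A.mulVec w = 0 →
        ∀ S : Finset (Fin n), S.card = k → (∀ i, i ∉ S → 0 ≤ w i) →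
          0 < ∑ i, w i) ↔
      (∀ S : Finset (Fin n), S.card = k →
        ¬ ∃ w : Fin n → ℝ, w ≠ 0 ∧ A.mulVec w = 0 ∧ ∀ i, i ∉ S → 0 ≤ w i)) := by
  have key : ∀ w : Fin n → ℝ, A.mulVec w = 0 → ∑ i, w i = 0 := by
    intro w hw
    have h1 : ∑ i, A.mulVec w i = d * ∑ j, w j := by
      simp only [Matrix.mulVec, dotProduct]
      rw [Finset.sum_comm, Finset.mul_sum]
      refine Finset.sum_congr rfl fun j _ => ?_
      rw [← Finset.sum_mul, hcol]
    rw [hw] at h1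
    simp only [Pi.zero_apply, Finset.sum_const_zero] at h1
    rcases mul_eq_zero.mp h1.symm with h | h
    · exact absurd h hd.ne'
    · exact h
  refine ⟨⟨?_, ?_⟩, ⟨?_, ?_⟩⟩
  · intro h w hw0 hw S hS hpos
    exfalso
    apply hw0
    have hx := h (fun i => max (-w i) 0) (fun i => le_max_right _ _) (by
      rw [← hS]
      apply Finset.card_le_card
      intro i hi
      by_contra hiS
      have := hpos i hiS
      simp only [Finset.mem_filter] at hi
      exact hi.2 (max_eq_right (by linarith)))
    have hsub : w = (fun i => max (w i) 0) - (fun i => max (-w i) 0) := by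
      funext i
      simp only [Pi.sub_apply]
      rcases le_total (w i) 0 with h' | h'
      · rw [max_eq_right h', max_eq_left (by linarith)]; ring
      · rw [max_eq_left h', max_eq_right (by linarith)]; ring
    have hmem : (fun i => max (w i) 0) ∈ {x : Fin n → ℝ | A.mulVec x =
        A.mulVec (fun i => max (-w i) 0) ∧ ∀ i, 0 ≤ x i} := by
      refine ⟨?_, fun i => le_max_right _ _⟩
      rw [← sub_eq_zero, ← Matrix.mulVec_sub, ← hsub, hw]
    rw [hx, Set.mem_singleton_iff] at hmem
    rw [hsub, hmem, sub_self]
  · intro h x₀ hx₀ hc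
    ext x
    simp only [Set.mem_setOf_eq, Set.mem_singleton_iff]
    constructor
    · rintro ⟨hx, hxp⟩
      by_contra hne
      obtain ⟨S, hsub, hS⟩ := Finset.exists_superset_card_eq hc (by simpa using hkn)
      have hn : A.mulVec (x - x₀) = 0 := by rw [Matrix.mulVec_sub, hx, sub_self]
      have := h (x - x₀) (sub_ne_zero.mpr hne) hn S hS (by
        intro i hi
        have h0 : x₀ i = 0 := by
          by_contra h0
          exact hi (hsub (by simp [h0]))
        simp [h0, hxp i])
      rw [key _ hn] at this
      exact lt_irrefl _ this
    · rintro rfl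
      exact ⟨rfl, hx₀⟩
  · rintro h S hS ⟨w, hw0, hw, hp⟩
    have := h w hw0 hw S hS hp
    rw [key _ hw] at this
    exact lt_irrefl _ this
  · intro h w hw0 hw S hS hp
    exact absurd ⟨w, hw0, hw, hp⟩ (h S hS)
end

section
/- Let A be an m×n real matrix with nonnegative entries whose column sums are all equal to a common constant d > 0, and let S ⊆ {1,…,n} be a fixed index set. Then the following three statements are equivalent: (1) for every nonnegative vector x₀ ∈ ℝⁿ supported on S (i.e., x₀_j = 0 for all j ∉ S), the set {x ∈ ℝⁿ : Ax = Ax₀, x ≥ 0} equals {x₀}; (2) every nonzero vector w in the null space of A whose entries with indices outside S are all nonnegative satisfies ∑_{i=1}^n w_i > 0; (3) there exists no nonzero vector w in the null space of A whose entries with indices outside S are all nonnegative. -/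
/-- For a nonnegative m×n matrix A with constant column sum d > 0 and a
fixed index set S, three conditions are equivalent: (1) every nonnegative x₀ supported
on S is the unique point of {x : Ax = Ax₀, x ≥ 0}; (2) every nonzero null-space vector
nonnegative outside S has positive entry sum; (3) there is no nonzero null-space vector
nonnegative outside S. -/
theorem stmt_2 (m n : ℕ) (d : ℝ) (hd : 0 < d)
    (A : Matrix (Fin m) (Fin n) ℝ) (hA : ∀ i j, 0 ≤ A i j)
    (hcol : ∀ j, ∑ i, A i j = d) (S : Finset (Fin n)) :
    ((∀ x₀ : Fin n → ℝ, (∀ i, 0 ≤ x₀ i) → (∀ j, j ∉ S → x₀ j = 0) →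
        {x : Fin n → ℝ | A.mulVec x = A.mulVec x₀ ∧ ∀ i, 0 ≤ x i} = {x₀}) ↔
      (∀ w : Fin n → ℝ, w ≠ 0 → A.mulVec w = 0 → (∀ i, i ∉ S → 0 ≤ w i) →
        0 < ∑ i, w i))
    ∧
    ((∀ w : Fin n → ℝ, w ≠ 0 → A.mulVec w = 0 → (∀ i, i ∉ S → 0 ≤ w i) →
        0 < ∑ i, w i) ↔
      (¬ ∃ w : Fin n → ℝ, w ≠ 0 ∧ A.mulVec w = 0 ∧ ∀ i, i ∉ S → 0 ≤ w i)) := by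
  have key : ∀ w : Fin n → ℝ, A.mulVec w = 0 → ∑ i, w i = 0 := by
    intro w hw
    have h1 : ∑ i, A.mulVec w i = d * ∑ j, w j := by
      simp only [Matrix.mulVec, dotProduct]
      rw [Finset.sum_comm, Finset.mul_sum]
      refine Finset.sum_congr rfl fun j _ => ?_
      rw [← Finset.sum_mul, hcol]
    rw [hw] at h1
    simp only [Pi.zero_apply, Finset.sum_const_zero] at h1
    rcases mul_eq_zero.mp h1.symm with h | h
    · exact absurd h hd.ne'
    · exact h
  have h23 : (∀ w : Fin n → ℝ, w ≠ 0 → A.mulVec w = 0 → (∀ i, i ∉ S → 0 ≤ w i) →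
        0 < ∑ i, w i) ↔
      (¬ ∃ w : Fin n → ℝ, w ≠ 0 ∧ A.mulVec w = 0 ∧ ∀ i, i ∉ S → 0 ≤ w i) := by
    constructor
    · rintro h ⟨w, h0, h1, h2⟩
      exact absurd (key w h1) (h w h0 h1 h2).ne'
    · intro h w h0 h1 h2
      exact absurd ⟨w, h0, h1, h2⟩ h
  refine ⟨?_, h23⟩
  rw [h23]
  constructor
  · rintro h ⟨w, h0, h1, h2⟩
    have h3 := h (fun i => max (-w i) 0) (fun i => le_max_right _ _)
      (fun j hj => max_eq_right (by linarith [h2 j hj]))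
    have hsub : (fun i => max (w i) 0) - (fun i => max (-w i) 0) = w := by
      funext i
      simp only [Pi.sub_apply]
      rcases le_total 0 (w i) with hi | hi
      · rw [max_eq_left hi, max_eq_right (by linarith)]; ring
      · rw [max_eq_right hi, max_eq_left (by linarith)]; ring
    have h4 : (fun i => max (w i) 0) ∈ {x : Fin n → ℝ |
        A.mulVec x = A.mulVec (fun i => max (-w i) 0) ∧ ∀ i, 0 ≤ x i} := by
      refine ⟨?_, fun i => le_max_right _ _⟩
      rw [← sub_eq_zero, ← Matrix.mulVec_sub, hsub, h1]
    rw [h3, Set.mem_singleton_iff] at h4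
    apply h0
    rw [← hsub, h4, sub_self]
  · intro h x₀ hx hS
    ext x
    simp only [Set.mem_setOf_eq, Set.mem_singleton_iff]
    constructor
    · rintro ⟨h1, h2⟩
      by_contra hne
      refine h ⟨x - x₀, sub_ne_zero.mpr hne, ?_, fun i hi => ?_⟩
      · rw [Matrix.mulVec_sub, h1, sub_self]
      · simpa [hS i hi] using h2 i
    · rintro rfl
      exact ⟨rfl, hx⟩
end

section
/- Let A be an m×n matrix with entries in {0,1} having exactly d ones in each column, where d ≥ 1, and let k be a positive integer with k < n/2. Then the following two statements are equivalent: (1) every nonnegative k-sparse vector x₀ ∈ ℝⁿ is the unique solution of the program: minimize ‖x‖₁ subject to Ax = Ax₀ and x ≥ 0; (2) every nonzero vector w in the null space of A has at least k+1 negative entries. -/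
/-- For a 0/1 matrix A with exactly d ≥ 1 ones per column and 0 < k < n/2,
every nonnegative k-sparse x₀ is the unique ℓ1 minimizer over {x ≥ 0 : Ax = Ax₀} iff
every nonzero null-space vector of A has at least k+1 negative entries. -/
theorem stmt_4 (m n k d : ℕ) (hd : 1 ≤ d) (hk : 0 < k) (hkn : (k : ℝ) < (n : ℝ) / 2)
    (A : Matrix (Fin m) (Fin n) ℝ)
    (h01 : ∀ i j, A i j = 0 ∨ A i j = 1)
    (hcol : ∀ j, (Finset.univ.filter (fun i => A i j = 1)).card = d) :
    (∀ x₀ : Fin n → ℝ, (∀ i, 0 ≤ x₀ i) →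
      (Finset.univ.filter (fun i => x₀ i ≠ 0)).card ≤ k →
      ∀ x : Fin n → ℝ, (∀ i, 0 ≤ x i) → A.mulVec x = A.mulVec x₀ → x ≠ x₀ →
        ∑ i, |x₀ i| < ∑ i, |x i|)
    ↔
    (∀ w : Fin n → ℝ, w ≠ 0 → A.mulVec w = 0 →
      k + 1 ≤ (Finset.univ.filter (fun i => w i < 0)).card) := by
  constructor
  · intro h w hw hAw
    by_contra hcon
    have hsum : ∑ j, w j = 0 := by
      have hc : ∀ j, ∑ i, A i j = (d : ℝ) := by
        intro j
        rw [← hcol j, Finset.card_filter]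
        push_cast
        refine Finset.sum_congr rfl fun i _ => ?_
        rcases h01 i j with h0 | h0 <;> simp [h0]
      have h1 : ∑ i, A.mulVec w i = 0 := by simp [hAw]
      simp only [Matrix.mulVec, dotProduct] at h1
      rw [Finset.sum_comm] at h1
      simp only [← Finset.sum_mul, hc] at h1
      rw [← Finset.mul_sum] at h1
      have hd' : (d : ℝ) ≠ 0 := by
        have : d ≠ 0 := by omega
        exact_mod_cast this
      exact (mul_eq_zero.mp h1).resolve_left hd'
    have hdiff : ∀ i, max (w i) 0 - max (-w i) 0 = w i := by
      intro i
      rcases le_total (w i) 0 with h0 | h0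
      · rw [max_eq_right h0, max_eq_left (by linarith)]; ring
      · rw [max_eq_left h0, max_eq_right (by linarith)]; ring
    have hfun : (fun i => max (w i) 0) - (fun i => max (-w i) 0) = w := funext hdiff
    have key := h (fun i => max (-w i) 0) (fun i => le_max_right _ _) ?_
      (fun i => max (w i) 0) (fun i => le_max_right _ _) ?_ ?_
    · simp only [abs_of_nonneg (le_max_right _ (0 : ℝ))] at key
      have : ∑ i, max (w i) 0 - ∑ i, max (-w i) 0 = 0 := by
        rw [← Finset.sum_sub_distrib]
        exact (Finset.sum_congr rfl fun i _ => hdiff i).trans hsum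
      linarith
    · refine le_trans (Finset.card_le_card ?_) (by omega : 
        (Finset.univ.filter (fun i => w i < 0)).card ≤ k)
      intro i hi
      simp only [Finset.mem_filter, Finset.mem_univ, true_and] at hi ⊢
      by_contra h0
      exact hi (max_eq_right (by linarith))
    · rw [← sub_eq_zero, ← Matrix.mulVec_sub, hfun, hAw]
    · intro he
      apply hw
      rw [← hfun, he, sub_self]
  · intro h x₀ hx₀ hcard x hx hA hne
    exfalso
    have h1 := h (x - x₀) (sub_ne_zero.mpr hne) (by rw [Matrix.mulVec_sub, hA, sub_self])
    have h2 : (Finset.univ.filter (fun i => (x - x₀) i < 0)).card ≤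
        (Finset.univ.filter (fun i => x₀ i ≠ 0)).card := by
      refine Finset.card_le_card ?_
      intro i hi
      simp only [Finset.mem_filter, Finset.mem_univ, true_and, Pi.sub_apply] at hi ⊢
      intro h0
      have := hx i
      linarith
    omega
end

section
/- Let A be an m×n matrix with entries in {0,1} having exactly d ones in each column, where d ≥ 1. Then every nonzero vector w in the null space of A has at least Cr(A)/d negative entries; that is, d·|{i : w_i < 0}| ≥ Cr(A). -/
/-- The complete rank Cr(A): the largest r₀ such that every set of r₀ columns of A is
linearly independent. -/
noncomputable def Cr {m n : ℕ} (A : Matrix (Fin m) (Fin n) ℝ) : ℕ :=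
  sSup {r : ℕ | r ≤ n ∧ ∀ S : Finset (Fin n), S.card ≤ r →
    LinearIndependent ℝ (fun j : {j // j ∈ S} => fun i => A i j.val)}

/-- for a 0/1 matrix with exactly d ≥ 1 ones per column, every nonzero
null-space vector w has at least Cr(A)/d negative entries: d·|{i : wᵢ < 0}| ≥ Cr(A). -/
theorem stmt_7 (m n d : ℕ) (hd : 1 ≤ d)
    (A : Matrix (Fin m) (Fin n) ℝ)
    (h01 : ∀ i j, A i j = 0 ∨ A i j = 1)
    (hcol : ∀ j, (Finset.univ.filter (fun i => A i j = 1)).card = d)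
    (w : Fin n → ℝ) (hw0 : w ≠ 0) (hw : A.mulVec w = 0) :
    Cr A ≤ d * (Finset.univ.filter (fun i => w i < 0)).card := by
  classical
  unfold Cr
  apply csSup_le'
  rintro r ⟨hrn, hr⟩
  set N := Finset.univ.filter (fun i => w i < 0) with hN
  set P := Finset.univ.filter (fun i => w i ≠ 0) with hP
  set R := N.biUnion (fun j => Finset.univ.filter (fun i => A i j = 1)) with hR
  have hRc : R.card ≤ d * N.card := by
    rw [mul_comm]
    exact Finset.card_biUnion_le_card_mul _ _ _ (fun j _ => (hcol j).le)
  have hsum : ∀ i, ∑ j, A i j * w j = 0 := fun i => congrFun hw i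
  have hsupp : ∀ j ∈ P, ∀ i, i ∉ R → A i j = 0 := by
    intro j hj i hi
    have h1 : ∀ k, w k < 0 → A i k = 0 := by
      intro k hk
      rcases h01 i k with h | h
      · exact h
      · exact absurd (Finset.mem_biUnion.2 ⟨k, by simp [hN, hk], by simp [h]⟩) hi
    have h2 : ∀ k ∈ Finset.univ, 0 ≤ A i k * w k := by
      intro k _
      by_cases hk : w k < 0
      · simp [h1 k hk]
      · apply mul_nonneg _ (not_lt.1 hk)
        rcases h01 i k with h | h <;> simp [h]
    have h3 := (Finset.sum_eq_zero_iff_of_nonneg h2).1 (hsum i) j (Finset.mem_univ _)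
    have h4 : w j ≠ 0 := by simpa [hP] using hj
    exact (mul_eq_zero.1 h3).resolve_right h4
  have hPr : r < P.card := by
    by_contra hcon
    have hli := hr P (not_lt.1 hcon)
    rw [Fintype.linearIndependent_iff] at hli
    apply hw0
    funext j
    by_contra hj
    have hjP : j ∈ P := by simpa [hP] using hj
    refine hj (hli (fun j => w j.1) ?_ ⟨j, hjP⟩)
    funext i
    simp only [Finset.sum_apply, Pi.smul_apply, smul_eq_mul, Pi.zero_apply]
    rw [Finset.sum_coe_sort P (fun j => w j * A i j), ← hsum i]
    simp_rw [mul_comm (w _)]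
    apply Finset.sum_subset (Finset.subset_univ _)
    intro k _ hk
    have : w k = 0 := by simpa [hP] using hk
    simp [this]
  obtain ⟨T, hTP, hTc⟩ := Finset.exists_subset_card_eq hPr.le
  have hli := hr T hTc.le
  let f : ({i // i ∈ R} → ℝ) →ₗ[ℝ] (Fin m → ℝ) :=
    { toFun := fun v i => if h : i ∈ R then v ⟨i, h⟩ else 0
      map_add' := by intro x y; funext i; by_cases h : i ∈ R <;> simp [h]
      map_smul' := by intro c x; funext i; by_cases h : i ∈ R <;> simp [h] }
  have hli2 : LinearIndependent ℝ
      (fun j : {j // j ∈ T} => fun i : {i // i ∈ R} => A i.1 j.1) := by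
    apply LinearIndependent.of_comp f
    convert hli using 1
    funext j i
    by_cases h : i ∈ R
    · simp [f, h]
    · simp [f, h, hsupp j.1 (hTP j.2) i h]
  have := hli2.fintype_card_le_finrank
  simp only [Fintype.card_coe, Module.finrank_fintype_fun_eq_card] at this
  omega
end

section
/- Let d ≥ 3 be an integer, let β ∈ (0,1), and let α satisfy 0 < α < e^{d/(2−d)}·β^{(1−d)/(2−d)}. Then there exist a constant λ > 0 and N such that for all integers n ≥ N, with m = ⌈βn⌉, the sum ∑_{r=d}^{⌊αn⌋} C(n,r)·C(m,r)·C(r,d)^r / C(m,d)^r is at most λ·n^{1−d(d−2)}, where C(a,b) denotes the binomial coefficient. -/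
open scoped Real

lemma aux_desc (r m : ℕ) (h : r ≤ m) (d : ℕ) :
    r.descFactorial d * m ^ d ≤ m.descFactorial d * r ^ d := by
  induction d with
  | zero => simp
  | succ d ih =>
    rw [Nat.descFactorial_succ, Nat.descFactorial_succ, pow_succ, pow_succ]
    have h1 : (r - d) * m ≤ (m - d) * r := by
      rw [Nat.sub_mul, Nat.sub_mul, mul_comm m r]
      have := Nat.mul_le_mul_left d h
      omega
    calc (r - d) * r.descFactorial d * (m ^ d * m)
        = (r.descFactorial d * m ^ d) * ((r - d) * m) := by ring
      _ ≤ (m.descFactorial d * r ^ d) * ((m - d) * r) := Nat.mul_le_mul ih h1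
      _ = _ := by ring

lemma aux_ratio (r m d : ℕ) (h : r ≤ m) (hm : 0 < m) (hdm : d ≤ m) :
    (r.choose d : ℝ) / (m.choose d : ℝ) ≤ ((r : ℝ) / m) ^ d := by
  have h1 := aux_desc r m h d
  rw [Nat.descFactorial_eq_factorial_mul_choose, Nat.descFactorial_eq_factorial_mul_choose,
    mul_assoc, mul_assoc] at h1
  have h2 := Nat.le_of_mul_le_mul_left h1 (Nat.factorial_pos d)
  have h3 : (r.choose d : ℝ) * (m : ℝ) ^ d ≤ m.choose d * (r : ℝ) ^ d := by exact_mod_cast h2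
  have hc : (0 : ℝ) < m.choose d := by exact_mod_cast Nat.choose_pos hdm
  have hm' : (0 : ℝ) < m := by exact_mod_cast hm
  rw [div_pow, div_le_div_iff₀ hc (by positivity)]
  linarith

lemma aux_choose (n r : ℕ) (hr : 0 < r) :
    (n.choose r : ℝ) ≤ (Real.exp 1 * n / r) ^ r := by
  have h1 : (n.choose r : ℝ) ≤ (n : ℝ) ^ r / (r.factorial : ℝ) := Nat.choose_le_pow_div r n
  have h2 : (r : ℝ) ^ r / (r.factorial : ℝ) ≤ Real.exp r :=
    Real.pow_div_factorial_le_exp (r : ℝ) (by positivity) r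
  have hf : (0 : ℝ) < r.factorial := by exact_mod_cast Nat.factorial_pos r
  have hr' : (0 : ℝ) < r := by exact_mod_cast hr
  have h3 : Real.exp 1 ^ r = Real.exp r := by rw [← Real.exp_nat_mul]; simp
  refine h1.trans ?_
  rw [div_pow, mul_pow, h3]
  rw [div_le_iff₀ hf] at h2
  rw [div_le_div_iff₀ hf (by positivity)]
  have : (0 : ℝ) ≤ (n : ℝ) ^ r := by positivity
  nlinarith

lemma aux_hyp (k : ℕ) (hk : 1 ≤ k) (β α : ℝ) (hβ0 : 0 < β) (hα0 : 0 < α)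
    (hα : α < Real.exp (((k + 2 : ℕ) : ℝ) / (2 - ((k + 2 : ℕ) : ℝ))) *
      β ^ ((1 - ((k + 2 : ℕ) : ℝ)) / (2 - ((k + 2 : ℕ) : ℝ)))) :
    α ^ k * Real.exp 1 ^ (k + 2) ≤ β ^ (k + 1) := by
  have hk' : (0 : ℝ) < k := by exact_mod_cast hk
  have h1 := Real.log_lt_log hα0 hα
  rw [Real.log_mul (by positivity) (by positivity), Real.log_exp, Real.log_rpow hβ0] at h1
  push_cast at h1
  have e1 : ((k : ℝ) + 2) / (2 - (k + 2)) + (1 - (k + 2)) / (2 - (k + 2)) * Real.log β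
      = (-(k + 2) + (k + 1) * Real.log β) / k := by
    have : (2 - ((k : ℝ) + 2)) = -k := by ring
    rw [this]; field_simp; ring
  rw [e1, lt_div_iff₀ hk'] at h1
  rw [← Real.log_le_log_iff (by positivity) (by positivity),
    Real.log_mul (by positivity) (by positivity), Real.log_pow, Real.log_pow, Real.log_pow,
    Real.log_exp]
  push_cast
  linarith

lemma aux_mono (k : ℕ) (K α x : ℝ) (hK : 0 < K) (hx : 0 < x) 
    (h : K * (Real.exp 1 * α) ^ k ≤ 1) (d r : ℕ) (hd : 0 < d) (hdr : d ≤ r) :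
    (r : ℝ) ≤ α * x → (K * ((r : ℝ) / x) ^ k) ^ r ≤ (K * ((d : ℝ) / x) ^ k) ^ d := by
  induction r, hdr using Nat.le_induction with
  | base => intro _; exact le_rfl
  | succ r hdr ih =>
    intro hr
    have hr0 : (0 : ℝ) < r := by exact_mod_cast (lt_of_lt_of_le hd hdr)
    push_cast at hr ⊢
    refine le_trans ?_ (ih (by linarith))
    have h1 : (((r : ℝ) + 1) / r) ^ r ≤ Real.exp 1 := by
      have : ((r : ℝ) + 1) / r ≤ Real.exp (1 / r) := by
        have := Real.add_one_le_exp (1 / (r : ℝ))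
        refine le_trans (le_of_eq ?_) this
        field_simp
        try ring
      calc (((r : ℝ) + 1) / r) ^ r ≤ Real.exp (1 / r) ^ r := by gcongr
        _ = Real.exp 1 := by rw [← Real.exp_nat_mul]; congr 1; field_simp
    have h2 : ((r : ℝ) + 1) / x ≤ α := by rw [div_le_iff₀ hx]; exact hr
    calc (K * (((r : ℝ) + 1) / x) ^ k) ^ (r + 1)
        = (K * ((r : ℝ) / x) ^ k) ^ r *
          (K * ((((r : ℝ) + 1) / r) ^ r * (((r : ℝ) + 1) / x)) ^ k) := by
          have : ((r : ℝ) + 1) / x = (r : ℝ) / x * (((r : ℝ) + 1) / r) := by field_simp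
          rw [pow_succ]
          nth_rewrite 1 [this]
          simp only [mul_pow, ← pow_mul]
          rw [mul_comm k r]
          ring
      _ ≤ (K * ((r : ℝ) / x) ^ k) ^ r * (K * (Real.exp 1 * α) ^ k) := by gcongr
      _ ≤ (K * ((r : ℝ) / x) ^ k) ^ r * 1 := by gcongr
      _ = _ := mul_one _

lemma aux_term (k n m r : ℕ) (β : ℝ) (hβ : 0 < β) (hn : 0 < n) (hm : β * n ≤ m)
    (hkr : k + 2 ≤ r) (hrm : r ≤ m) :
    ((n.choose r : ℝ) * (m.choose r : ℝ) * ((r.choose (k + 2) : ℝ)) ^ r) /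
      ((m.choose (k + 2) : ℝ)) ^ r ≤
    (Real.exp 1 ^ 2 / β ^ (k + 1) * ((r : ℝ) / n) ^ k) ^ r := by
  have hr0 : 0 < r := by omega
  have hm0 : 0 < m := by omega
  have hr' : (0 : ℝ) < r := by exact_mod_cast hr0
  have hm' : (0 : ℝ) < m := by exact_mod_cast hm0
  have hn' : (0 : ℝ) < n := by exact_mod_cast hn
  rw [mul_div_assoc, ← div_pow]
  calc _ ≤ (Real.exp 1 * n / r) ^ r * (Real.exp 1 * m / r) ^ r * (((r : ℝ) / m) ^ (k + 2)) ^ r := by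
        gcongr
        · exact aux_choose n r hr0
        · exact aux_choose m r hr0
        · exact aux_ratio r m (k + 2) hrm hm0 (by omega)
    _ = (Real.exp 1 ^ 2 * n * (r : ℝ) ^ k / (m : ℝ) ^ (k + 1)) ^ r := by
        rw [← mul_pow, ← mul_pow]; congr 1; rw [div_pow]; field_simp; try ring
    _ ≤ (Real.exp 1 ^ 2 * n * (r : ℝ) ^ k / (β * n) ^ (k + 1)) ^ r := by gcongr
    _ = _ := by congr 1; rw [div_pow, mul_pow]; field_simp; try ring



/-- for an integer d ≥ 3, β ∈ (0,1) and
0 < α < e^{d/(2−d)} β^{(1−d)/(2−d)}, the sublinear part of the union bound,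
∑_{r=d}^{⌊αn⌋} C(n,r) C(m,r) C(r,d)^r / C(m,d)^r with m = ⌈βn⌉, is O(n^{1−d(d−2)}). -/
theorem stmt_13 (d : ℕ) (hd : 3 ≤ d) (β α : ℝ) (hβ0 : 0 < β) (hβ1 : β < 1)
    (hα0 : 0 < α)
    (hα : α < Real.exp ((d : ℝ) / (2 - (d : ℝ))) *
      β ^ ((1 - (d : ℝ)) / (2 - (d : ℝ)))) :
    ∃ lam : ℝ, 0 < lam ∧ ∃ N : ℕ, ∀ n : ℕ, N ≤ n →
      ∑ r ∈ Finset.Icc d ⌊α * (n : ℝ)⌋₊,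
        ((n.choose r : ℝ) * ((⌈β * (n : ℝ)⌉₊).choose r : ℝ) *
          ((r.choose d : ℝ)) ^ r) / (((⌈β * (n : ℝ)⌉₊).choose d : ℝ)) ^ r
      ≤ lam * (n : ℝ) ^ ((1 : ℤ) - (d : ℤ) * ((d : ℤ) - 2)) := by
  obtain ⟨k, rfl⟩ : ∃ k, d = k + 2 := ⟨d - 2, by omega⟩
  have hk : 1 ≤ k := by omega
  have hyp := aux_hyp k hk β α hβ0 hα0 hα
  have hαβ : α ≤ β := by
    by_contra hc
    push Not at hc
    have h1 : β ^ k < α ^ k := pow_lt_pow_left₀ hc hβ0.le (by omega)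
    have h2 : 1 ≤ Real.exp 1 ^ (k + 2) := one_le_pow₀ (Real.one_le_exp (by norm_num))
    have h3 : β ^ (k + 1) ≤ β ^ k := pow_le_pow_of_le_one hβ0.le hβ1.le (by omega)
    have h4 : α ^ k ≤ α ^ k * Real.exp 1 ^ (k + 2) := le_mul_of_one_le_right (by positivity) h2
    linarith
  set K : ℝ := Real.exp 1 ^ 2 / β ^ (k + 1) with hK
  have hK0 : 0 < K := by positivity
  have hKα : K * (Real.exp 1 * α) ^ k ≤ 1 := by
    rw [hK, div_mul_eq_mul_div, div_le_one (by positivity)]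
    refine le_trans (le_of_eq ?_) hyp
    rw [mul_pow]; ring
  refine ⟨α * (K * ((k + 2 : ℕ) : ℝ) ^ k) ^ (k + 2), by positivity, 1, fun n hn => ?_⟩
  have hn' : (0 : ℝ) < n := by exact_mod_cast hn
  have hT : ∀ r ∈ Finset.Icc (k + 2) ⌊α * (n : ℝ)⌋₊,
      ((n.choose r : ℝ) * ((⌈β * (n : ℝ)⌉₊).choose r : ℝ) *
          ((r.choose (k + 2) : ℝ)) ^ r) / (((⌈β * (n : ℝ)⌉₊).choose (k + 2) : ℝ)) ^ r
      ≤ (K * (((k + 2 : ℕ) : ℝ) / n) ^ k) ^ (k + 2) := by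
    intro r hr
    rw [Finset.mem_Icc] at hr
    have hr1 : (r : ℝ) ≤ α * n := (Nat.le_floor_iff (by positivity)).1 hr.2
    have hm := Nat.le_ceil (β * (n : ℝ))
    have hrm : r ≤ ⌈β * (n : ℝ)⌉₊ := by
      have : (r : ℝ) ≤ (⌈β * (n : ℝ)⌉₊ : ℝ) := by nlinarith
      exact_mod_cast this
    exact (aux_term k n _ r β hβ0 hn hm hr.1 hrm).trans
      (aux_mono k K α n hK0 hn' hKα (k + 2) r (by omega) hr.1 hr1)
  refine (Finset.sum_le_card_nsmul _ _ _ hT).trans ?_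
  rw [nsmul_eq_mul]
  have hcard : ((Finset.Icc (k + 2) ⌊α * (n : ℝ)⌋₊).card : ℝ) ≤ α * n := by
    rw [Nat.card_Icc]
    refine le_trans ?_ (Nat.floor_le (show 0 ≤ α * (n : ℝ) by positivity))
    exact_mod_cast (by omega)
  refine (mul_le_mul_of_nonneg_right hcard (by positivity)).trans (le_of_eq ?_)
  have e : (1 : ℤ) - ((k + 2 : ℕ) : ℤ) * (((k + 2 : ℕ) : ℤ) - 2) = 1 - ((k * (k + 2) : ℕ) : ℤ) := by
    push_cast; ring
  rw [e, zpow_sub₀ hn'.ne', zpow_one, zpow_natCast, div_pow, ← mul_div_assoc, div_pow, ← pow_mul]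
  ring
end

section
/- Let A be an m×n real matrix with nonnegative entries, and let x₀ ∈ ℝⁿ be a fixed nonnegative vector whose support is exactly the index set S (i.e., x₀_j > 0 for j ∈ S and x₀_j = 0 for j ∉ S). Then x₀ is the unique solution of the program: minimize ‖x‖₁ subject to Ax = Ax₀ and x ≥ 0, if and only if every nonzero vector w in the null space of A whose entries with indices outside S are all nonnegative satisfies ∑_{i=1}^n w_i > 0. -/
/-- for a nonnegative m×n matrix A and a fixed nonnegative x₀ with support
exactly S, x₀ is the unique ℓ1 minimizer over {x ≥ 0 : Ax = Ax₀} iff every nonzero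
null-space vector of A that is nonnegative outside S has positive entry sum. -/
theorem stmt_16 (m n : ℕ) (A : Matrix (Fin m) (Fin n) ℝ) (hA : ∀ i j, 0 ≤ A i j)
    (S : Finset (Fin n)) (x₀ : Fin n → ℝ) (hx₀ : ∀ i, 0 ≤ x₀ i)
    (hsupp : ∀ j, j ∈ S ↔ 0 < x₀ j) :
    (∀ x : Fin n → ℝ, (∀ i, 0 ≤ x i) → A.mulVec x = A.mulVec x₀ → x ≠ x₀ →
      ∑ i, |x₀ i| < ∑ i, |x i|)
    ↔
    (∀ w : Fin n → ℝ, w ≠ 0 → A.mulVec w = 0 → (∀ i, i ∉ S → 0 ≤ w i) →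
      0 < ∑ i, w i) := by
  constructor
  · intro h w hw hAw hS
    have key : ∀ᶠ t in nhdsWithin (0:ℝ) (Set.Ioi 0), ∀ i, 0 ≤ x₀ i + t * w i := by
      rw [Filter.eventually_all]
      intro i
      by_cases hi : i ∈ S
      · have hc : Filter.Tendsto (fun t : ℝ => x₀ i + t * w i) (nhds 0)
            (nhds (x₀ i + 0 * w i)) :=
          Continuous.tendsto (by fun_prop) 0
        have hp : 0 < x₀ i + 0 * w i := by simpa using (hsupp i).1 hi
        have he := hc.eventually (lt_mem_nhds hp)
        exact (he.filter_mono nhdsWithin_le_nhds).mono fun t ht => le_of_lt ht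
      · filter_upwards [self_mem_nhdsWithin] with t ht
        exact add_nonneg (hx₀ i) (mul_nonneg (le_of_lt ht) (hS i hi))
    obtain ⟨t, ht, ht0⟩ := (key.and self_mem_nhdsWithin).exists
    have ht0 : 0 < t := ht0
    have h1 := h (x₀ + t • w) (fun i => by simpa using ht i)
      (by rw [Matrix.mulVec_add, Matrix.mulVec_smul, hAw]; simp)
      (by
        intro he
        have h2 : t • w = 0 := by simpa using he
        exact hw ((smul_eq_zero.1 h2).resolve_left ht0.ne'))
    have e1 : ∑ i, |x₀ i| = ∑ i, x₀ i :=
      Finset.sum_congr rfl fun i _ => abs_of_nonneg (hx₀ i)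
    have e2 : ∑ i, |(x₀ + t • w) i| = ∑ i, x₀ i + t * ∑ i, w i := by
      rw [Finset.mul_sum, ← Finset.sum_add_distrib]
      exact Finset.sum_congr rfl fun i _ => abs_of_nonneg (ht i)
    rw [e1, e2] at h1
    exact pos_of_mul_pos_right (by linarith : 0 < t * ∑ i, w i) ht0.le
  · intro h x hx hAx hne
    have h1 := h (x - x₀) (sub_ne_zero.2 hne)
      (by rw [Matrix.mulVec_sub, hAx, sub_self])
      (by
        intro i hi
        have h2 : ¬ 0 < x₀ i := fun hp => hi ((hsupp i).2 hp)
        have h3 := hx i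
        simp only [Pi.sub_apply]
        linarith)
    have e1 : ∑ i, |x₀ i| = ∑ i, x₀ i :=
      Finset.sum_congr rfl fun i _ => abs_of_nonneg (hx₀ i)
    have e2 : ∑ i, |x i| = ∑ i, x i :=
      Finset.sum_congr rfl fun i _ => abs_of_nonneg (hx i)
    simp only [Pi.sub_apply, Finset.sum_sub_distrib] at h1
    rw [e1, e2]
    linarith
end

section
/- Let A be an m×n matrix with entries in {0,1} having exactly d ones in each column, where d ≥ 1, and let x₀ ∈ ℝⁿ be a fixed nonnegative vector whose support is exactly the index set S (i.e., x₀_j > 0 for j ∈ S and x₀_j = 0 for j ∉ S). Then x₀ is the unique solution of the program: minimize ‖x‖₁ subject to Ax = Ax₀ and x ≥ 0, if and only if there exists no nonzero vector w in the null space of A whose entries with indices outside S are all nonnegative. -/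
/-- for a 0/1 matrix A with exactly d ≥ 1 ones per column and a fixed
nonnegative x₀ with support exactly S, x₀ is the unique ℓ1 minimizer over
{x ≥ 0 : Ax = Ax₀} iff there is no nonzero null-space vector of A that is nonnegative
outside S. -/
theorem stmt_17 (m n d : ℕ) (hd : 1 ≤ d)
    (A : Matrix (Fin m) (Fin n) ℝ)
    (h01 : ∀ i j, A i j = 0 ∨ A i j = 1)
    (hcol : ∀ j, (Finset.univ.filter (fun i => A i j = 1)).card = d)
    (S : Finset (Fin n)) (x₀ : Fin n → ℝ) (hx₀ : ∀ i, 0 ≤ x₀ i)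
    (hsupp : ∀ j, j ∈ S ↔ 0 < x₀ j) :
    (∀ x : Fin n → ℝ, (∀ i, 0 ≤ x i) → A.mulVec x = A.mulVec x₀ → x ≠ x₀ →
      ∑ i, |x₀ i| < ∑ i, |x i|)
    ↔
    (¬ ∃ w : Fin n → ℝ, w ≠ 0 ∧ A.mulVec w = 0 ∧ ∀ i, i ∉ S → 0 ≤ w i) := by
  constructor
  · rintro h ⟨w, hw, hA, hS⟩
    have hcs : ∀ j, ∑ i, A i j = (d : ℝ) := by
      intro j
      rw [← hcol j, Finset.card_filter]
      push_cast
      refine Finset.sum_congr rfl fun i _ => ?_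
      rcases h01 i j with h | h <;> simp [h]
    have hsum : ∑ j, w j = 0 := by
      have h1 : ∑ i, (A.mulVec w) i = 0 := by simp [hA]
      simp only [Matrix.mulVec, dotProduct] at h1
      rw [Finset.sum_comm] at h1
      simp only [← Finset.sum_mul, hcs] at h1
      rw [← Finset.mul_sum] at h1
      rcases mul_eq_zero.mp h1 with h2 | h2
      · have : d = 0 := by exact_mod_cast h2
        omega
      · exact h2
    have hev : ∀ᶠ t in nhdsWithin (0 : ℝ) (Set.Ioi 0), ∀ i, 0 ≤ x₀ i + t * w i := by
      rw [Filter.eventually_all]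
      intro i
      by_cases hi : i ∈ S
      · have hp := (hsupp i).1 hi
        have hc : Filter.Tendsto (fun t : ℝ => x₀ i + t * w i) (nhds 0) (nhds (x₀ i)) := by
          have : Continuous (fun t : ℝ => x₀ i + t * w i) := by fun_prop
          simpa using this.tendsto 0
        exact ((hc.eventually (lt_mem_nhds hp)).filter_mono nhdsWithin_le_nhds).mono
          fun t ht => le_of_lt ht
      · filter_upwards [self_mem_nhdsWithin] with t ht
        have ht' : (0 : ℝ) < t := ht
        exact add_nonneg (hx₀ i) (mul_nonneg ht'.le (hS i hi))
    obtain ⟨t, ht, ht0⟩ := (hev.and self_mem_nhdsWithin).exists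
    have ht0' : (0 : ℝ) < t := ht0
    have key := h (x₀ + t • w) (fun i => by simpa using ht i)
      (by rw [Matrix.mulVec_add, Matrix.mulVec_smul, hA]; simp)
      (by
        intro he
        have : t • w = 0 := by simpa using he
        rcases smul_eq_zero.mp this with h1 | h1
        · exact ht0'.ne' h1
        · exact hw h1)
    have e1 : ∑ i, |x₀ i| = ∑ i, x₀ i :=
      Finset.sum_congr rfl fun i _ => abs_of_nonneg (hx₀ i)
    have e2 : ∑ i, |(x₀ + t • w) i| = ∑ i, x₀ i := by
      rw [Finset.sum_congr rfl fun i _ => abs_of_nonneg (by simpa using ht i)]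
      simp [Finset.sum_add_distrib, ← Finset.mul_sum, hsum]
    rw [e1, e2] at key
    exact lt_irrefl _ key
  · intro h x hx hA hne
    refine absurd ⟨x - x₀, sub_ne_zero.mpr hne, ?_, ?_⟩ h
    · rw [Matrix.mulVec_sub, hA, sub_self]
    · intro i hi
      have : x₀ i = 0 := le_antisymm (not_lt.mp fun hp => hi ((hsupp i).2 hp)) (hx₀ i)
      simpa [this] using hx i
end

section
/- Let k, d be positive integers and let Ã be an m×n real matrix with nonnegative entries, with exactly d nonzero entries in each column, and such that every collection of at most kd+1 columns of Ã is linearly independent (i.e., Cr(Ã) ≥ kd+1). Let x ∈ ℝⁿ be a nonnegative k-sparse vector and y = Ãx. Define T₁ = {i : y_i = 0} and T₂ = {1,…,m} \ T₁, and define S₁ = {j : Ã_{ij} ≠ 0 for some i ∈ T₁} and S₂ = {1,…,n} \ S₁. Then: (1) y has at most kd nonzero entries, i.e., |T₂| ≤ kd; (2) |S₂| ≤ |T₂| and the submatrix of Ã with rows indexed by T₂ and columns indexed by S₂ has linearly independent columns; (3) x_j = 0 for every j ∈ S₁, and the restriction of x to S₂ is the unique vector z (indexed by S₂) satisfying Ã[T₂,S₂]·z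 = y restricted to T₂; consequently x is uniquely determined from y by this procedure. -/
/-- validity of the reverse expansion recovery algorithm: let Ã be a
nonnegative m×n matrix with exactly d nonzero entries per column such that every set of
at most kd+1 columns is linearly independent. Let x be nonnegative and k-sparse,
y = Ãx, T₁ the set of zero coordinates of y, T₂ its complement, S₁ the set of columns
meeting a row of T₁, and S₂ its complement. Then (1) |T₂| ≤ kd; (2) |S₂| ≤ |T₂| and the
submatrix Ã[T₂,S₂] has linearly independent columns; (3) x vanishes on S₁ and the
restriction of x to S₂ is the unique z with Ã[T₂,S₂]·z = y|T₂. -/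
theorem stmt_18 (m n k d : ℕ) (hk : 0 < k) (hd : 0 < d)
    (Atil : Matrix (Fin m) (Fin n) ℝ) (hA : ∀ i j, 0 ≤ Atil i j)
    (hcolcard : ∀ j, (Finset.univ.filter (fun i => Atil i j ≠ 0)).card = d)
    (hCr : ∀ S : Finset (Fin n), S.card ≤ k * d + 1 →
      LinearIndependent ℝ (fun j : {j // j ∈ S} => fun i => Atil i j.val))
    (x : Fin n → ℝ) (hx : ∀ j, 0 ≤ x j)
    (hxs : (Finset.univ.filter (fun j => x j ≠ 0)).card ≤ k)
    (y : Fin m → ℝ) (hy : y = Atil.mulVec x)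
    (T₁ T₂ : Finset (Fin m)) (S₁ S₂ : Finset (Fin n))
    (hT₁ : T₁ = Finset.univ.filter (fun i => y i = 0))
    (hT₂ : T₂ = T₁ᶜ)
    (hS₁ : S₁ = Finset.univ.filter (fun j => ∃ i ∈ T₁, Atil i j ≠ 0))
    (hS₂ : S₂ = S₁ᶜ) :
    T₂.card ≤ k * d ∧
    (S₂.card ≤ T₂.card ∧
      LinearIndependent ℝ
        (fun j : {j // j ∈ S₂} => fun i : {i // i ∈ T₂} => Atil i.val j.val)) ∧
    ((∀ j ∈ S₁, x j = 0) ∧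
      ∀ z : {j // j ∈ S₂} → ℝ,
        (∀ i : {i // i ∈ T₂}, ∑ j : {j // j ∈ S₂}, Atil i.val j.val * z j = y i.val)
        ↔ (∀ j : {j // j ∈ S₂}, z j = x j.val)) := by
  have hAz : ∀ i ∉ T₂, ∀ j ∈ S₂, Atil i j = 0 := by
    intro i hi j hj
    subst hS₂ hS₁ hT₂
    simp only [Finset.mem_compl, not_not, Finset.mem_filter, Finset.mem_univ, true_and,
      not_exists, not_and] at hi hj
    exact hj i hi
  have hT₂' : ∀ i, i ∈ T₂ ↔ y i ≠ 0 := by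
    intro i
    subst hT₂ hT₁
    simp
  have hxS : ∀ j ∈ S₁, x j = 0 := by
    intro j hj
    subst hS₁ hT₁
    simp only [Finset.mem_filter, Finset.mem_univ, true_and] at hj
    obtain ⟨i, hi, hij⟩ := hj
    rw [hy] at hi
    simp only [Matrix.mulVec, dotProduct] at hi
    rw [Finset.sum_eq_zero_iff_of_nonneg (fun j _ => mul_nonneg (hA i j) (hx j))] at hi
    exact (mul_eq_zero.mp (hi j (Finset.mem_univ j))).resolve_left hij
  have hxS' : ∀ j, j ∉ S₂ → x j = 0 := by
    intro j hj
    apply hxS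
    subst hS₂
    simpa using hj
  have h1 : T₂.card ≤ k * d := by
    have hsub : T₂ ⊆ (Finset.univ.filter (fun j => x j ≠ 0)).biUnion
        (fun j => Finset.univ.filter (fun i => Atil i j ≠ 0)) := by
      intro i hi
      rw [hT₂', hy] at hi
      simp only [Matrix.mulVec, dotProduct] at hi
      obtain ⟨j, _, hj⟩ := Finset.exists_ne_zero_of_sum_ne_zero hi
      simp only [Finset.mem_biUnion, Finset.mem_filter, Finset.mem_univ, true_and]
      exact ⟨j, right_ne_zero_of_mul hj, left_ne_zero_of_mul hj⟩
    calc T₂.card ≤ _ := Finset.card_le_card hsub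
      _ ≤ (Finset.univ.filter (fun j => x j ≠ 0)).card * d :=
        Finset.card_biUnion_le_card_mul _ _ _ (fun j _ => (hcolcard j).le)
      _ ≤ k * d := Nat.mul_le_mul_right d hxs
  have key : ∀ S : Finset (Fin n), S ⊆ S₂ → S.card ≤ k * d + 1 →
      LinearIndependent ℝ
        (fun j : {j // j ∈ S} => fun i : {i // i ∈ T₂} => Atil i.val j.val) := by
    intro S hS hc
    have h := hCr S hc
    rw [Fintype.linearIndependent_iff] at h ⊢
    intro g hg
    apply h g
    funext i
    by_cases hi : i ∈ T₂
    · have := congrFun hg ⟨i, hi⟩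
      simpa [Finset.sum_apply] using this
    · simp only [Finset.sum_apply, Pi.smul_apply, smul_eq_mul, Pi.zero_apply]
      exact Finset.sum_eq_zero (fun j _ => by rw [hAz i hi j.1 (hS j.2), mul_zero])
  have hcard : ∀ S : Finset (Fin n), S ⊆ S₂ → S.card ≤ k * d + 1 → S.card ≤ T₂.card := by
    intro S hS hc
    have := (key S hS hc).fintype_card_le_finrank
    simpa using this
  have h2 : S₂.card ≤ T₂.card := by
    by_contra hlt
    obtain ⟨S, hS, hSc⟩ := Finset.exists_subset_card_eq (show T₂.card + 1 ≤ S₂.card by omega)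
    have := hcard S hS (by omega)
    omega
  have h3 := key S₂ (Finset.Subset.refl _) (by omega)
  have hyx : ∀ i, ∑ j : {j // j ∈ S₂}, Atil i j.val * x j.val = y i := by
    intro i
    rw [hy, Finset.sum_coe_sort S₂ (fun j => Atil i j * x j)]
    exact Finset.sum_subset (Finset.subset_univ _) (fun j _ hj => by rw [hxS' j hj, mul_zero])
  refine ⟨h1, ⟨h2, h3⟩, hxS, fun z => ⟨fun hz j => ?_, fun hz i => ?_⟩⟩
  · rw [Fintype.linearIndependent_iff] at h3
    refine sub_eq_zero.mp (h3 (fun j => z j - x j.val) ?_ j)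
    funext i
    simp only [Finset.sum_apply, Pi.smul_apply, smul_eq_mul, Pi.zero_apply]
    rw [← sub_self (y i.val)]
    nth_rewrite 1 [← hz i]
    rw [← hyx i.val, ← Finset.sum_sub_distrib]
    exact Finset.sum_congr rfl (fun j _ => by ring)
  · rw [← hyx i.val]
    exact Finset.sum_congr rfl (fun j _ => by rw [hz j])
end
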